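/- Let k ∈ ℕ and ν ∈ {+,−}, and let (λ_k^ν, u_k^ν) be a solution of the half-quasilinear problem −(φ_p(u'))' = λ a(x) φ_p(u) + α(x) φ_p(u⁺) + β(x) φ_p(u⁻) on (0,1), u(0) = u(1) = 0, with u_k^ν ∈ S_k^ν. Then any solution (λ, u) of this problem with u ∈ S_k^ν satisfies λ = λ_k^ν and u = c u_k^ν for some constant c > 0. -/

import Mathlib

open Set Filter Topology

/-- `φ_p(s) = |s|^{p-2} s`. -/
noncomputable def phip (p s : ℝ) : ℝ := |s| ^ (p - 2) * s

/-- membership in the space `E = {u ∈ C¹[0,1] : u 0 = u 1 = 0}`. -/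
def MemE (u : ℝ → ℝ) : Prop := ContDiff ℝ 1 u ∧ u 0 = 0 ∧ u 1 = 0

/-- `u` is nontrivial on `[0,1]`. -/
def Nontriv (u : ℝ → ℝ) : Prop := ∃ x ∈ Set.Icc (0:ℝ) 1, u x ≠ 0

/-- `u ∈ S_k^ν` (ν = 1 or -1): u ∈ E, exactly k-1 interior zeros in (0,1), all zeros of u in
[0,1] simple, and ν·u positive near 0. -/
def MemS (k : ℕ) (ν : ℝ) (u : ℝ → ℝ) : Prop :=
  MemE u ∧
  {x ∈ Ioo (0:ℝ) 1 | u x = 0}.Finite ∧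
  {x ∈ Ioo (0:ℝ) 1 | u x = 0}.ncard = k - 1 ∧
  (∀ x ∈ Icc (0:ℝ) 1, u x = 0 → deriv u x ≠ 0) ∧
  ∃ δ > 0, ∀ x ∈ Ioo (0:ℝ) δ, 0 < ν * u x

/-- the `C¹` norm `‖u‖ = max_{[0,1]} |u| + max_{[0,1]} |u'|` of `E`. -/
noncomputable def normE (u : ℝ → ℝ) : ℝ :=
  (⨆ x : Icc (0:ℝ) 1, |u x|) + (⨆ x : Icc (0:ℝ) 1, |deriv u x|)

/-- `u` solves `-(φ_p(u'))' = λ a φ_p(u) + α φ_p(u⁺) + β φ_p(u⁻)` on (0,1), u(0)=u(1)=0. -/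
def IsHalfSol (p : ℝ) (a α β : ℝ → ℝ) (lam : ℝ) (u : ℝ → ℝ) : Prop :=
  MemE u ∧ ∀ x ∈ Set.Ioo (0:ℝ) 1,
    HasDerivAt (fun y => phip p (deriv u y))
      (-(lam * a x * phip p (u x) + α x * phip p (max (u x) 0)
         + β x * phip p (-min (u x) 0))) x

lemma phip_mul (p s t : ℝ) : phip p (s * t) = phip p s * phip p t := by
  simp only [phip, abs_mul, Real.mul_rpow (abs_nonneg s) (abs_nonneg t)]
  ring

lemma phip_zero (p : ℝ) : phip p 0 = 0 := by simp [phip]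

lemma phip_one (p : ℝ) : phip p 1 = 1 := by simp [phip]

lemma phip_neg (p s : ℝ) : phip p (-s) = -phip p s := by simp [phip]

lemma phip_of_pos (p : ℝ) {s : ℝ} (hs : 0 < s) : phip p s = s ^ (p - 1) := by
  rw [phip, abs_of_pos hs, ← Real.rpow_add_one hs.ne']
  congr 1
  ring

lemma abs_phip {p : ℝ} (hp : 1 < p) (s : ℝ) : |phip p s| = |s| ^ (p - 1) := by
  rcases eq_or_ne s 0 with rfl | hs
  · rw [phip_zero, abs_zero, Real.zero_rpow (by linarith)]
  · rw [← phip_of_pos p (abs_pos.2 hs), phip, phip, abs_mul, abs_abs,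
      abs_of_nonneg (Real.rpow_nonneg (abs_nonneg s) _)]

lemma continuous_phip {p : ℝ} (hp : 1 < p) : Continuous (phip p) := by
  refine continuous_iff_continuousAt.2 fun s => ?_
  rcases eq_or_ne s 0 with rfl | hs
  · rw [ContinuousAt, phip_zero, tendsto_zero_iff_abs_tendsto_zero]
    have h : Tendsto (fun s : ℝ => |s| ^ (p - 1)) (𝓝 0) (𝓝 (|0| ^ (p - 1))) :=
      (continuous_abs.tendsto 0).rpow_const (Or.inr (by linarith))
    rw [abs_zero, Real.zero_rpow (by linarith)] at h
    exact h.congr fun s => (abs_phip hp s).symm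
  · exact (continuous_abs.continuousAt.rpow_const (Or.inl (abs_ne_zero.2 hs))).mul continuousAt_id

lemma mul_phip_nonneg (p s : ℝ) : 0 ≤ s * phip p s := by
  have : s * phip p s = |s| ^ (p - 2) * (s * s) := by rw [phip]; ring
  rw [this]
  exact mul_nonneg (Real.rpow_nonneg (abs_nonneg s) _) (mul_self_nonneg s)

lemma mul_phip_pos (p : ℝ) {s : ℝ} (hs : s ≠ 0) : 0 < s * phip p s := by
  have : s * phip p s = |s| ^ (p - 2) * (s * s) := by rw [phip]; ring
  rw [this]
  exact mul_pos (Real.rpow_pos_of_pos (abs_pos.2 hs) _) (mul_self_pos.2 hs)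

/-- Strict convexity of `t ↦ |t| ^ p`, compared with its tangent at `1`. -/
lemma tangent_phip_one_pos {p : ℝ} (hp : 1 < p) {t : ℝ} (ht : t ≠ 1) :
    0 < t * phip p t - p * t + (p - 1) := by
  rcases le_or_gt t 0 with h | h
  · nlinarith [mul_phip_nonneg p t]
  · have hB := one_add_mul_self_lt_rpow_one_add (s := t - 1) (by linarith) (sub_ne_zero.2 ht) hp
    have e : t * phip p t = (1 + (t - 1)) ^ p := by
      rw [phip_of_pos p h, mul_comm, ← Real.rpow_add_one h.ne']
      congr 1 <;> ring
    linarith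

/-- Strict convexity of `t ↦ |t| ^ p`. -/
lemma tangent_phip_pos {p : ℝ} (hp : 1 < p) {x y : ℝ} (h : x ≠ y) :
    0 < x * phip p x - p * x * phip p y + (p - 1) * (y * phip p y) := by
  rcases eq_or_ne y 0 with rfl | hy
  · simpa [phip_zero] using mul_phip_pos p h
  · have hxy : x / y ≠ 1 := fun e => h ((div_eq_one_iff_eq hy).1 e)
    have hx : x = x / y * y := by field_simp
    have key := mul_pos (tangent_phip_one_pos hp hxy) (mul_phip_pos p hy)
    have e : phip p x = phip p (x / y) * phip p y := by rw [← phip_mul, ← hx]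
    rw [e]
    generalize x / y = t at *
    subst hx
    linarith

lemma tangent_phip_nonneg {p : ℝ} (hp : 1 < p) (x y : ℝ) :
    0 ≤ x * phip p x - p * x * phip p y + (p - 1) * (y * phip p y) := by
  rcases eq_or_ne x y with rfl | h
  · exact le_of_eq (by ring)
  · exact (tangent_phip_pos hp h).le

/-- A quotient `u / v` has a limit at a zero of `u` which is not a multiple zero of `v`. -/
lemma exists_tendsto_div {u v : ℝ → ℝ} {u' v' c : ℝ} (hu : HasDerivAt u u' c)
    (hv : HasDerivAt v v' c) (huc : u c = 0) (hvc : v c = 0 → v' ≠ 0) :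
    ∃ L, Tendsto (fun x => u x / v x) (𝓝[≠] c) (𝓝 L) := by
  by_cases h : v c = 0
  · refine ⟨u' / v', ((hasDerivAt_iff_tendsto_slope.1 hu).div
      (hasDerivAt_iff_tendsto_slope.1 hv) (hvc h)).congr' ?_⟩
    filter_upwards [self_mem_nhdsWithin] with x hx
    have hx' : x - c ≠ 0 := sub_ne_zero.2 hx
    simp only [Pi.div_apply, slope_def_field, huc, h, sub_zero]
    exact div_div_div_cancel_right₀ hx' _ _
  · exact ⟨u c / v c, (hu.continuousAt.div hv.continuousAt h).tendsto.mono_left nhdsWithin_le_nhds⟩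

/-- The quantity whose derivative is computed by Picone's identity. -/
noncomputable def picone (p : ℝ) (u u' v v' : ℝ → ℝ) (x : ℝ) : ℝ :=
  u x * (phip p (u' x) - (u x / v x) ^ (p - 1) * phip p (v' x))

lemma tendsto_picone {p : ℝ} (hp : 1 < p) {u u' v v' : ℝ → ℝ} {c : ℝ}
    (hu : HasDerivAt u (u' c) c) (hv : HasDerivAt v (v' c) c) (hu' : Continuous u')
    (hv' : Continuous v') (huc : u c = 0) (hvc : v c = 0 → v' c ≠ 0) :
    Tendsto (picone p u u' v v') (𝓝[≠] c) (𝓝 0) := by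
  obtain ⟨L, hL⟩ := exists_tendsto_div hu hv huc hvc
  have h1 : Tendsto u (𝓝[≠] c) (𝓝 0) := by
    simpa [huc] using hu.continuousAt.tendsto.mono_left nhdsWithin_le_nhds
  have h2 := (((continuous_phip hp).comp hu').tendsto c).mono_left
    (nhdsWithin_le_nhds (s := {c}ᶜ))
  have h3 := (((continuous_phip hp).comp hv').tendsto c).mono_left
    (nhdsWithin_le_nhds (s := {c}ᶜ))
  have h4 := h1.mul (h2.sub ((hL.rpow_const (p := p - 1) (Or.inr (by linarith))).mul h3))
  rw [zero_mul] at h4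
  exact h4

/-- Picone's identity. -/
lemma hasDerivAt_picone {p : ℝ} {u u' v v' : ℝ → ℝ} {q r x : ℝ}
    (hu : HasDerivAt u (u' x) x) (hv : HasDerivAt v (v' x) x) (hux : 0 < u x) (hvx : 0 < v x)
    (hu' : HasDerivAt (fun y => phip p (u' y)) (-(q * u x ^ (p - 1))) x)
    (hv' : HasDerivAt (fun y => phip p (v' y)) (-(r * v x ^ (p - 1))) x) :
    HasDerivAt (picone p u u' v v')
      ((u' x * phip p (u' x) - p * u' x * phip p (u x / v x * v' x)
        + (p - 1) * (u x / v x * v' x * phip p (u x / v x * v' x)))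
        + (r - q) * (u x * u x ^ (p - 1))) x := by
  have ht : 0 < u x / v x := div_pos hux hvx
  have h := hu.mul (hu'.sub (((hu.div hv hvx.ne').rpow_const (p := p - 1)
    (Or.inl ht.ne')).mul hv'))
  refine h.congr_deriv ?_
  rw [phip_mul, phip_of_pos p ht]
  have e1 : (u x / v x) ^ (p - 1) = (u x / v x) ^ (p - 1 - 1) * (u x / v x) := by
    rw [← Real.rpow_add_one ht.ne']; congr 1; ring
  have e2 : u x ^ (p - 1) = (u x / v x) ^ (p - 1) * v x ^ (p - 1) := by
    rw [← Real.mul_rpow ht.le hvx.le]; congr 1; field_simp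
  simp only [Pi.div_apply, Pi.mul_apply, Pi.sub_apply]
  rw [e2, e1]
  generalize (u x / v x) ^ (p - 1 - 1) = A
  generalize v x ^ (p - 1) = B
  field_simp
  ring

/-- Sturm-Picone comparison for positive solutions, including the case of equality. -/
lemma picone_comparison {p : ℝ} (hp : 1 < p) {u u' v v' q r : ℝ → ℝ} {c d : ℝ} (hcd : c < d)
    (hu : ∀ x, HasDerivAt u (u' x) x) (hv : ∀ x, HasDerivAt v (v' x) x)
    (hu' : Continuous u') (hv' : Continuous v')
    (hup : ∀ x ∈ Ioo c d, 0 < u x) (hvp : ∀ x ∈ Ioo c d, 0 < v x)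
    (huc : u c = 0) (hud : u d = 0) (hvc : v c = 0 → v' c ≠ 0) (hvd : v d = 0 → v' d ≠ 0)
    (hueq : ∀ x ∈ Ioo c d, HasDerivAt (fun y => phip p (u' y)) (-(q x * u x ^ (p - 1))) x)
    (hveq : ∀ x ∈ Ioo c d, HasDerivAt (fun y => phip p (v' y)) (-(r x * v x ^ (p - 1))) x)
    (hqr : ∀ x ∈ Ioo c d, q x ≤ r x) :
    (∃ C > 0, ∀ x ∈ Icc c d, u x = C * v x) ∧ ∀ x ∈ Ioo c d, q x = r x := by
  have hder := fun x hx => hasDerivAt_picone (hu x) (hv x) (hup x hx) (hvp x hx) (hueq x hx)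
    (hveq x hx)
  have hmono : MonotoneOn (picone p u u' v v') (Ioo c d) := by
    refine monotoneOn_of_deriv_nonneg (convex_Ioo c d)
      (fun x hx => (hder x hx).continuousAt.continuousWithinAt) ?_ ?_
    · rw [interior_Ioo]
      exact fun x hx => (hder x hx).differentiableAt.differentiableWithinAt
    · rw [interior_Ioo]
      intro x hx
      rw [(hder x hx).deriv]
      exact add_nonneg (tangent_phip_nonneg hp _ _) (mul_nonneg (sub_nonneg.2 (hqr x hx))
        (mul_nonneg (hup x hx).le (Real.rpow_nonneg (hup x hx).le _)))
  have hzero : ∀ x ∈ Ioo c d, picone p u u' v v' x = 0 := by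
    intro x hx
    apply le_antisymm
    · refine ge_of_tendsto ((tendsto_picone hp (hu d) (hv d) hu' hv' hud hvd).mono_left
        (nhdsLT_le_nhdsNE d)) ?_
      filter_upwards [Ioo_mem_nhdsLT hx.2] with y hy
      exact hmono hx ⟨hx.1.trans hy.1, hy.2⟩ hy.1.le
    · refine le_of_tendsto ((tendsto_picone hp (hu c) (hv c) hu' hv' huc hvc).mono_left
        (nhdsGT_le_nhdsNE c)) ?_
      filter_upwards [Ioo_mem_nhdsGT hx.1] with y hy
      exact hmono ⟨hy.1, hy.2.trans hx.2⟩ hx hy.2.le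
  have hsum : ∀ x ∈ Ioo c d, u' x = u x / v x * v' x ∧ q x = r x := by
    intro x hx
    have h0 : HasDerivAt (picone p u u' v v') 0 x := by
      refine (hasDerivAt_const x (0 : ℝ)).congr_of_eventuallyEq ?_
      filter_upwards [Ioo_mem_nhds hx.1 hx.2] with y hy using hzero y hy
    have h1 := (hder x hx).unique h0
    have hw : 0 < u x * u x ^ (p - 1) := mul_pos (hup x hx) (Real.rpow_pos_of_pos (hup x hx) _)
    have h2 := mul_nonneg (sub_nonneg.2 (hqr x hx)) hw.le
    have h3 := tangent_phip_nonneg hp (u' x) (u x / v x * v' x)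
    constructor
    · by_contra hne
      linarith [tangent_phip_pos hp hne]
    · have h4 : (r x - q x) * (u x * u x ^ (p - 1)) = 0 := by linarith
      rcases mul_eq_zero.1 h4 with h | h
      · linarith
      · exact absurd h hw.ne'
  refine ⟨?_, fun x hx => (hsum x hx).2⟩
  have hm : (c + d) / 2 ∈ Ioo c d := ⟨by linarith, by linarith⟩
  have hquot : ∀ x ∈ Ioo c d, HasDerivAt (fun y => u y / v y) 0 x := by
    intro x hx
    have hvx := (hvp x hx).ne'
    refine ((hu x).div (hv x) hvx).congr_deriv ?_
    rw [(hsum x hx).1]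
    field_simp
    ring
  have hconst : ∀ x ∈ Ioo c d, u x / v x = u ((c + d) / 2) / v ((c + d) / 2) := fun x hx =>
    isOpen_Ioo.is_const_of_deriv_eq_zero isPreconnected_Ioo
      (fun y hy => (hquot y hy).differentiableAt.differentiableWithinAt)
      (fun y hy => (hquot y hy).deriv) hx hm
  refine ⟨u ((c + d) / 2) / v ((c + d) / 2), div_pos (hup _ hm) (hvp _ hm), ?_⟩
  have huC : Continuous u := continuous_iff_continuousAt.2 fun x => (hu x).continuousAt
  have hvC : Continuous v := continuous_iff_continuousAt.2 fun x => (hv x).continuousAt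
  have hsub : EqOn u (fun x => u ((c + d) / 2) / v ((c + d) / 2) * v x) (Ioo c d) := by
    intro x hx
    have hvx := (hvp x hx).ne'
    simp only
    rw [← hconst x hx]
    field_simp
  have := hsub.closure huC (continuous_const.mul hvC)
  rwa [closure_Ioo hcd.ne] at this

lemma MemE.hasDerivAt {u : ℝ → ℝ} (hu : MemE u) (x : ℝ) : HasDerivAt u (deriv u x) x :=
  (hu.1.differentiable (by norm_num) x).hasDerivAt

lemma MemE.continuous_deriv {u : ℝ → ℝ} (hu : MemE u) : Continuous (deriv u) :=
  hu.1.continuous_deriv (by norm_num)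

/-- Where `σ u > 0`, the half-quasilinear equation is a half-linear equation for `σ u`. -/
lemma IsHalfSol.hasDerivAt_signed {p : ℝ} {a α β : ℝ → ℝ} {lam : ℝ} {u : ℝ → ℝ}
    (hu : IsHalfSol p a α β lam u) {σ : ℝ} (hσ : σ = 1 ∨ σ = -1) {x : ℝ} (hx : x ∈ Ioo (0 : ℝ) 1)
    (hpos : 0 < σ * u x) :
    HasDerivAt (fun y => phip p (σ * deriv u y))
      (-((lam * a x + if σ = 1 then α x else -β x) * (σ * u x) ^ (p - 1))) x := by
  have h := (hu.2 x hx).const_mul (phip p σ)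
  have e : (fun y => phip p (σ * deriv u y)) = fun y => phip p σ * phip p (deriv u y) :=
    funext fun y => phip_mul p σ _
  rw [e]
  refine h.congr_deriv ?_
  rw [← phip_of_pos p hpos]
  rcases hσ with rfl | rfl
  · have h1 : 0 < u x := by linarith
    rw [max_eq_left h1.le, min_eq_right h1.le, if_pos rfl, one_mul, phip_one, neg_zero, phip_zero]
    ring
  · have h1 : u x < 0 := by linarith
    rw [max_eq_right h1.le, min_eq_left h1.le, if_neg (by norm_num), neg_one_mul, phip_neg,
      phip_neg, phip_one, phip_zero]
    ring

/-- Comparison on a common nodal interval of two solutions of the half-quasilinear problem. -/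
lemma IsHalfSol.comparison {p : ℝ} (hp : 1 < p) {a α β : ℝ → ℝ}
    (hapos : ∀ x ∈ Icc (0 : ℝ) 1, 0 < a x) {lam μ : ℝ} {u v : ℝ → ℝ}
    (hu : IsHalfSol p a α β lam u) (hv : IsHalfSol p a α β μ v) (hle : lam ≤ μ)
    (hvs : ∀ x ∈ Icc (0 : ℝ) 1, v x = 0 → deriv v x ≠ 0)
    {σ : ℝ} (hσ : σ = 1 ∨ σ = -1) {c d : ℝ} (hc : 0 ≤ c) (hcd : c < d) (hd : d ≤ 1)
    (hup : ∀ x ∈ Ioo c d, 0 < σ * u x) (hvp : ∀ x ∈ Ioo c d, 0 < σ * v x)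
    (huc : u c = 0) (hud : u d = 0) :
    (∃ C > 0, ∀ x ∈ Icc c d, u x = C * v x) ∧ lam = μ := by
  have hσ0 : σ ≠ 0 := by rcases hσ with rfl | rfl <;> norm_num
  have hI : ∀ x ∈ Ioo c d, x ∈ Ioo (0 : ℝ) 1 := fun x hx =>
    ⟨hc.trans_lt hx.1, hx.2.trans_le hd⟩
  have hsimple : ∀ x ∈ Icc (0 : ℝ) 1, σ * v x = 0 → σ * deriv v x ≠ 0 := fun x hx h =>
    mul_ne_zero hσ0 (hvs x hx ((mul_eq_zero.1 h).resolve_left hσ0))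
  obtain ⟨⟨C, hC, h⟩, hq⟩ := picone_comparison hp hcd
    (fun x => (hu.1.hasDerivAt x).const_mul σ) (fun x => (hv.1.hasDerivAt x).const_mul σ)
    (continuous_const.mul hu.1.continuous_deriv) (continuous_const.mul hv.1.continuous_deriv)
    hup hvp (by rw [huc, mul_zero]) (by rw [hud, mul_zero])
    (hsimple c ⟨hc, hcd.le.trans hd⟩) (hsimple d ⟨hc.trans hcd.le, hd⟩)
    (fun x hx => hu.hasDerivAt_signed hσ (hI x hx) (hup x hx))
    (fun x hx => hv.hasDerivAt_signed hσ (hI x hx) (hvp x hx))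
    (fun x hx => by
      have := mul_le_mul_of_nonneg_right hle (hapos x (Ioo_subset_Icc_self (hI x hx))).le
      linarith)
  refine ⟨⟨C, hC, fun x hx => mul_left_cancel₀ hσ0 ?_⟩, ?_⟩
  · rw [h x hx]; ring
  · have hm : (c + d) / 2 ∈ Ioo c d := ⟨by linarith, by linarith⟩
    exact mul_right_cancel₀ (hapos _ (Ioo_subset_Icc_self (hI _ hm))).ne'
      (add_right_cancel (hq _ hm))

/-- `s 0 < ⋯ < s k` are the endpoints of the `k` nodal intervals of `u` in `[0,1]`, with
`ν (-1)^j u` positive on the `j`-th one. -/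
structure IsNodal (k : ℕ) (ν : ℝ) (u : ℝ → ℝ) (s : ℕ → ℝ) : Prop where
  zero : s 0 = 0
  last : s k = 1
  mem : ∀ j, s j ∈ Icc (0 : ℝ) 1
  lt : ∀ j < k, s j < s (j + 1)
  root : ∀ j, u (s j) = 0
  pos : ∀ j < k, ∀ x ∈ Ioo (s j) (s (j + 1)), 0 < ν * (-1) ^ j * u x

/-- A function without zeros on an interval which is positive somewhere is positive. -/
lemma pos_of_forall_ne_zero {f : ℝ → ℝ} (hf : Continuous f) {c d : ℝ}
    (hne : ∀ x ∈ Ioo c d, f x ≠ 0) {y : ℝ} (hy : y ∈ Ioo c d) (hfy : 0 < f y) :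
    ∀ x ∈ Ioo c d, 0 < f x := by
  intro x hx
  by_contra! h
  obtain ⟨z, hz, hz0⟩ := isPreconnected_Ioo.intermediate_value hx hy hf.continuousOn
    (show (0 : ℝ) ∈ Icc (f x) (f y) from ⟨h, hfy.le⟩)
  exact hne z hz hz0

/-- A function which is positive to the left of a simple zero is negative to its right. -/
lemma exists_neg_right {f : ℝ → ℝ} {f' c d e : ℝ} (hf : HasDerivAt f f' d) (hfd : f d = 0)
    (hf' : f' ≠ 0) (hcd : c < d) (hde : d < e) (hpos : ∀ x ∈ Ioo c d, 0 < f x) :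
    ∃ x ∈ Ioo d e, f x < 0 := by
  have hs := hasDerivAt_iff_tendsto_slope.1 hf
  have hle : f' ≤ 0 := by
    refine le_of_tendsto (hs.mono_left (nhdsLT_le_nhdsNE d)) ?_
    filter_upwards [Ioo_mem_nhdsLT hcd] with y hy
    rw [slope_def_field, hfd, sub_zero]
    exact div_nonpos_of_nonneg_of_nonpos (hpos y hy).le (by linarith [hy.2])
  have hlt : f' < 0 := lt_of_le_of_ne hle hf'
  have hev := (hs.mono_left (nhdsGT_le_nhdsNE d)).eventually
    (gt_mem_nhds hlt)
  obtain ⟨x, hx, hxI⟩ := (hev.and (Ioo_mem_nhdsGT hde)).exists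
  refine ⟨x, hxI, ?_⟩
  rw [slope_def_field, hfd, sub_zero] at hx
  exact (div_neg_iff.1 hx).resolve_left (fun h => by linarith [h.2, hxI.1]) |>.1

lemma MemS.exists_isNodal {k : ℕ} (hk : 1 ≤ k) {ν : ℝ} (hν : ν = 1 ∨ ν = -1) {u : ℝ → ℝ}
    (hu : MemS k ν u) : ∃ s, IsNodal k ν u s := by
  obtain ⟨hE, hfin, hcard, hsimple, δ, hδ, hpos⟩ := hu
  have hν0 : ν ≠ 0 := by rcases hν with rfl | rfl <;> norm_num
  have hcont : Continuous u := hE.1.continuous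
  set Z : Finset ℝ := insert 0 (insert 1 hfin.toFinset) with hZ
  have hmemZ : ∀ x, x ∈ Z ↔ x ∈ Icc (0 : ℝ) 1 ∧ u x = 0 := by
    intro x
    simp only [hZ, Finset.mem_insert, Set.Finite.mem_toFinset, mem_ofPred_eq]
    constructor
    · rintro (rfl | rfl | h)
      · exact ⟨by simp, hE.2.1⟩
      · exact ⟨by simp, hE.2.2⟩
      · exact ⟨Ioo_subset_Icc_self h.1, h.2⟩
    · rintro ⟨⟨h0, h1⟩, h⟩
      rcases h0.eq_or_lt with h0 | h0
      · exact Or.inl h0.symm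
      rcases h1.eq_or_lt with h1 | h1
      · exact Or.inr (Or.inl h1)
      exact Or.inr (Or.inr ⟨⟨h0, h1⟩, h⟩)
  have hZcard : Z.card = k + 1 := by
    rw [hZ, Finset.card_insert_of_notMem (by simp), Finset.card_insert_of_notMem (by simp),
      ← Set.ncard_eq_toFinset_card _ hfin, hcard]
    omega
  set e := Z.orderEmbOfFin hZcard with he
  have hemem : ∀ i, e i ∈ Z := fun i => Z.orderEmbOfFin_mem hZcard i
  have hsurj : ∀ x ∈ Z, ∃ i, e i = x := fun x hx => by
    have : x ∈ Set.range e := by rw [he, Finset.range_orderEmbOfFin]; exact hx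
    exact this
  have he0 : e 0 = 0 := by
    obtain ⟨i, hi⟩ := hsurj 0 ((hmemZ 0).2 ⟨by simp, hE.2.1⟩)
    exact le_antisymm (hi ▸ e.monotone (Fin.zero_le i)) ((hmemZ _).1 (hemem 0)).1.1
  have hek : e (Fin.last k) = 1 := by
    obtain ⟨i, hi⟩ := hsurj 1 ((hmemZ 1).2 ⟨by simp, hE.2.2⟩)
    exact le_antisymm ((hmemZ _).1 (hemem _)).1.2 (hi ▸ e.monotone (Fin.le_last i))
  let s : ℕ → ℝ := fun j => if h : j < k + 1 then e ⟨j, h⟩ else 1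
  have hs : ∀ j (h : j < k + 1), s j = e ⟨j, h⟩ := fun j h => dif_pos h
  have hsZ : ∀ j, s j ∈ Z := by
    intro j
    by_cases h : j < k + 1
    · rw [hs j h]; exact hemem _
    · rw [show s j = 1 from dif_neg h, ← hek]; exact hemem _
  have hs0 : s 0 = 0 := (hs 0 (by omega)).trans he0
  have hlt : ∀ j < k, s j < s (j + 1) := fun j hj => by
    rw [hs j (by omega), hs (j + 1) (by omega)]
    exact e.strictMono (Fin.mk_lt_mk.2 (Nat.lt_succ_self j))
  have hroot : ∀ j, u (s j) = 0 := fun j => ((hmemZ _).1 (hsZ j)).2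
  have hmem : ∀ j, s j ∈ Icc (0 : ℝ) 1 := fun j => ((hmemZ _).1 (hsZ j)).1
  have hne : ∀ j < k, ∀ x ∈ Ioo (s j) (s (j + 1)), u x ≠ 0 := by
    intro j hj x hx h0
    obtain ⟨i, rfl⟩ := hsurj x ((hmemZ x).2
      ⟨⟨(hmem j).1.trans hx.1.le, hx.2.le.trans (hmem (j + 1)).2⟩, h0⟩)
    rw [hs j (by omega), hs (j + 1) (by omega)] at hx
    have h1 := Fin.lt_def.1 (e.lt_iff_lt.1 hx.1)
    have h2 := Fin.lt_def.1 (e.lt_iff_lt.1 hx.2)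
    simp only at h1 h2
    omega
  have hσ0 : ∀ j, ν * (-1) ^ j ≠ 0 := fun j => mul_ne_zero hν0 (pow_ne_zero j (by norm_num))
  have hsign : ∀ j < k, ∀ x ∈ Ioo (s j) (s (j + 1)), 0 < ν * (-1) ^ j * u x := by
    intro j
    induction j with
    | zero =>
      intro hj
      have h1 : 0 < s 1 := hs0 ▸ hlt 0 hj
      have hm : 0 < min δ (s 1) := lt_min hδ h1
      refine pos_of_forall_ne_zero (f := fun x => ν * (-1) ^ 0 * u x) (continuous_const.mul hcont)
        (fun x hx => mul_ne_zero (hσ0 0) (hne 0 hj x hx)) (y := min δ (s 1) / 2) ?_ ?_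
      · rw [hs0]
        exact ⟨by linarith, by simp only [zero_add]; linarith [min_le_right δ (s 1)]⟩
      · have := hpos (min δ (s 1) / 2) ⟨by linarith, by linarith [min_le_left δ (s 1)]⟩
        simpa using this
    | succ j ih =>
      intro hj
      obtain ⟨y, hy, hy0⟩ := exists_neg_right
        ((hE.hasDerivAt (s (j + 1))).const_mul (ν * (-1) ^ j)) (by rw [hroot, mul_zero])
        (mul_ne_zero (hσ0 j) (hsimple _ (hmem _) (hroot _)))
        (hlt j (by omega)) (hlt (j + 1) hj) (ih (by omega))
      refine pos_of_forall_ne_zero (f := fun x => ν * (-1) ^ (j + 1) * u x)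
        (continuous_const.mul hcont)
        (fun x hx => mul_ne_zero (hσ0 _) (hne _ hj x hx)) hy ?_
      simp only [pow_succ]
      linarith
  exact ⟨s, hs0, (hs k (by omega)).trans hek, hmem, hlt, hroot, hsign⟩

lemma sign_mul_neg_one_pow {ν : ℝ} (hν : ν = 1 ∨ ν = -1) (j : ℕ) :
    ν * (-1) ^ j = 1 ∨ ν * (-1) ^ j = -1 := by
  rcases hν with rfl | rfl <;> rcases neg_one_pow_eq_or ℝ j with h | h <;> simp [h]

/-- The nodes of the solution with the larger parameter come first. -/
lemma IsNodal.le_of_le {p : ℝ} (hp : 1 < p) {a α β : ℝ → ℝ}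
    (hapos : ∀ x ∈ Icc (0 : ℝ) 1, 0 < a x) {lam μ : ℝ} {u v : ℝ → ℝ}
    (hu : IsHalfSol p a α β lam u) (hv : IsHalfSol p a α β μ v) (hle : lam ≤ μ)
    (hvs : ∀ x ∈ Icc (0 : ℝ) 1, v x = 0 → deriv v x ≠ 0)
    {k : ℕ} {ν : ℝ} (hν : ν = 1 ∨ ν = -1) {s t : ℕ → ℝ} (hs : IsNodal k ν u s)
    (ht : IsNodal k ν v t) {j : ℕ} (hj : j ≤ k) : t j ≤ s j := by
  induction j with
  | zero => rw [hs.zero, ht.zero]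
  | succ j ih =>
    have ih := ih (by omega)
    by_contra! h
    have hlt := hs.lt j hj
    obtain ⟨⟨C, hC, hCv⟩, -⟩ := hu.comparison hp hapos hv hle hvs (sign_mul_neg_one_pow hν j)
      (hs.mem j).1 hlt (hs.mem (j + 1)).2 (hs.pos j hj)
      (fun x hx => ht.pos j hj x ⟨ih.trans_lt hx.1, hx.2.trans h⟩) (hs.root j) (hs.root (j + 1))
    have h0 := hCv (s (j + 1)) ⟨hlt.le, le_rfl⟩
    rw [hs.root] at h0
    have hvpos := ht.pos j hj (s (j + 1)) ⟨ih.trans_lt hlt, h⟩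
    rw [(mul_eq_zero.1 h0.symm).resolve_left hC.ne', mul_zero] at hvpos
    exact hvpos.false

lemma IsNodal.eq_of_le {p : ℝ} (hp : 1 < p) {a α β : ℝ → ℝ}
    (hapos : ∀ x ∈ Icc (0 : ℝ) 1, 0 < a x) {lam μ : ℝ} {u v : ℝ → ℝ}
    (hu : IsHalfSol p a α β lam u) (hv : IsHalfSol p a α β μ v) (hle : lam ≤ μ)
    (hvs : ∀ x ∈ Icc (0 : ℝ) 1, v x = 0 → deriv v x ≠ 0)
    {k : ℕ} (hk : 1 ≤ k) {ν : ℝ} (hν : ν = 1 ∨ ν = -1) {s t : ℕ → ℝ} (hs : IsNodal k ν u s)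
    (ht : IsNodal k ν v t) : lam = μ := by
  obtain ⟨j, rfl⟩ : ∃ j, k = j + 1 := ⟨k - 1, by omega⟩
  have hj : j < j + 1 := Nat.lt_succ_self j
  have hts := IsNodal.le_of_le hp hapos hu hv hle hvs hν hs ht hj.le
  exact (hu.comparison hp hapos hv hle hvs (sign_mul_neg_one_pow hν j)
    (hs.mem j).1 (hs.lt j hj) (hs.mem (j + 1)).2 (hs.pos j hj)
    (fun x hx => ht.pos j hj x ⟨hts.trans_lt hx.1, by rw [ht.last, ← hs.last]; exact hx.2⟩)
    (hs.root j) (hs.root (j + 1))).2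

lemma deriv_eq_mul_of_eqOn_Icc {u v : ℝ → ℝ} {C c d x : ℝ} (hcd : c < d) (hx : x ∈ Icc c d)
    (hu : HasDerivAt u (deriv u x) x) (hv : HasDerivAt v (deriv v x) x)
    (h : ∀ y ∈ Icc c d, u y = C * v y) : deriv u x = C * deriv v x :=
  (uniqueDiffOn_Icc hcd x hx).eq_deriv _ hu.hasDerivWithinAt
    ((hv.const_mul C).hasDerivWithinAt.congr h (h x hx))

/-- Solutions with the same parameter and the same number of nodes are proportional. -/
lemma IsNodal.exists_eq_mul {p : ℝ} (hp : 1 < p) {a α β : ℝ → ℝ}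
    (hapos : ∀ x ∈ Icc (0 : ℝ) 1, 0 < a x) {lam : ℝ} {u v : ℝ → ℝ}
    (hu : IsHalfSol p a α β lam u) (hv : IsHalfSol p a α β lam v)
    (hus : ∀ x ∈ Icc (0 : ℝ) 1, u x = 0 → deriv u x ≠ 0)
    (hvs : ∀ x ∈ Icc (0 : ℝ) 1, v x = 0 → deriv v x ≠ 0)
    {k : ℕ} (hk : 1 ≤ k) {ν : ℝ} (hν : ν = 1 ∨ ν = -1) {s t : ℕ → ℝ} (hs : IsNodal k ν u s)
    (ht : IsNodal k ν v t) : ∃ C > 0, ∀ x ∈ Icc (0 : ℝ) 1, u x = C * v x := by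
  have hst : ∀ j ≤ k, t j = s j := fun j hj =>
    le_antisymm (IsNodal.le_of_le hp hapos hu hv le_rfl hvs hν hs ht hj)
      (IsNodal.le_of_le hp hapos hv hu le_rfl hus hν ht hs hj)
  have hloc : ∀ j < k, ∃ C > 0, ∀ x ∈ Icc (s j) (s (j + 1)), u x = C * v x := fun j hj =>
    (hu.comparison hp hapos hv le_rfl hvs (sign_mul_neg_one_pow hν j)
      (hs.mem j).1 (hs.lt j hj) (hs.mem (j + 1)).2 (hs.pos j hj)
      (by rw [← hst j hj.le, ← hst (j + 1) hj]; exact ht.pos j hj)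
      (hs.root j) (hs.root (j + 1))).1
  obtain ⟨C, hC, h0⟩ := hloc 0 hk
  refine ⟨C, hC, ?_⟩
  have hall : ∀ j < k, ∀ x ∈ Icc 0 (s (j + 1)), u x = C * v x := by
    intro j
    induction j with
    | zero => intro _; rw [hs.zero] at h0; exact h0
    | succ j ih =>
      intro hj
      have ih := ih (by omega)
      obtain ⟨D, -, hD⟩ := hloc (j + 1) hj
      have hjlt := hs.lt (j + 1) hj
      have hpos : 0 < s (j + 1) := (hs.mem j).1.trans_lt (hs.lt j (by omega))
      have e1 := deriv_eq_mul_of_eqOn_Icc hpos ⟨hpos.le, le_rfl⟩ (hu.1.hasDerivAt _)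
        (hv.1.hasDerivAt _) ih
      have e2 := deriv_eq_mul_of_eqOn_Icc hjlt ⟨le_rfl, hjlt.le⟩ (hu.1.hasDerivAt _)
        (hv.1.hasDerivAt _) hD
      have hv0 : v (s (j + 1)) = 0 := by rw [← hst (j + 1) hj.le]; exact ht.root _
      have hCD : C = D := mul_right_cancel₀ (hvs _ (hs.mem _) hv0) (e1.symm.trans e2)
      subst hCD
      intro x hx
      rcases le_total x (s (j + 1)) with h | h
      · exact ih x ⟨hx.1, h⟩
      · exact hD x ⟨h, hx.2⟩
  have := hall (k - 1) (by omega)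
  rwa [Nat.sub_add_cancel hk, hs.last] at this

/-- Uniqueness claim in the proof of Theorem 1.2: any solution `(λ, u)` of the
half-quasilinear problem with `u ∈ S_k^ν` satisfies `λ = λ_k^ν` and `u = c u_k^ν`, `c > 0`. -/
theorem stmt14 (p : ℝ) (hp : 1 < p)
    (a α β : ℝ → ℝ)
    (ha : ContinuousOn a (Icc 0 1)) (hapos : ∀ x ∈ Icc (0:ℝ) 1, 0 < a x)
    (hα : ContinuousOn α (Icc 0 1)) (hβ : ContinuousOn β (Icc 0 1))
    (k : ℕ) (hk : 1 ≤ k) (ν : ℝ) (hν : ν = 1 ∨ ν = -1)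
    -- the given solution (λ_k^ν, u_k^ν) with u_k^ν ∈ S_k^ν
    (lamk : ℝ) (uk : ℝ → ℝ)
    (huk : IsHalfSol p a α β lamk uk) (hukS : MemS k ν uk)
    -- any other solution (λ, u) with u ∈ S_k^ν
    (lam : ℝ) (u : ℝ → ℝ)
    (hu : IsHalfSol p a α β lam u) (huS : MemS k ν u) :
    lam = lamk ∧ ∃ c > (0:ℝ), ∀ x ∈ Icc (0:ℝ) 1, u x = c * uk x := by
  obtain ⟨s, hs⟩ := huS.exists_isNodal hk hν
  obtain ⟨t, ht⟩ := hukS.exists_isNodal hk hν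
  have hus := huS.2.2.2.1
  have hvs := hukS.2.2.2.1
  have hlam : lam = lamk := by
    rcases le_total lam lamk with h | h
    · exact IsNodal.eq_of_le hp hapos hu huk h hvs hk hν hs ht
    · exact (IsNodal.eq_of_le hp hapos huk hu h hus hk hν ht hs).symm
  subst hlam
  exact ⟨rfl, IsNodal.exists_eq_mul hp hapos hu huk hus hvs hk hν hs ht⟩
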